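/- arXiv:2212.08795 — 4 statements merged into one kernel-verified Lean document; each statement's English description precedes it below -/
import Mathlib

section
/- Let S(n,k) denote the number of Dyck words of semilength n with exactly k returns. For all integers n, k with 1 ≤ k ≤ n, the number of Dyck words of semilength n with exactly k returns equals the sum over j from k−1 to n−1 of the number of Dyck words of semilength n−1 with exactly j returns; that is, S(n,k) = ∑_{j=k−1}^{n−1} S(n−1,j). -/
/-- `w` is a Dyck word: `true` is an up-step (U), `false` is a down-step (D);
every prefix has at least as many U's as D's, and the whole word is balanced. -/
def IsDyckWord (w : List Bool) : Prop :=
  (∀ i : ℕ, (w.take i).count false ≤ (w.take i).count true) ∧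
    w.count false = w.count true

/-- The number of returns of a word: the number of nonempty balanced prefixes,
i.e. the number of (down-)steps after which the running count of U's minus D's is `0`. -/
def dyckReturns (w : List Bool) : ℕ :=
  ((Finset.Icc 1 w.length).filter
    (fun i => (w.take i).count true = (w.take i).count false)).card

/-- `dyckCount n k` (the quantity `S(n,k)`): the number of Dyck words of
semilength `n` with exactly `k` returns. -/
noncomputable def dyckCount (n k : ℕ) : ℕ :=
  Set.ncard {w : List Bool | w.length = 2 * n ∧ IsDyckWord w ∧ dyckReturns w = k}

/-- The number of indices `i ≤ w.length` at which the path coded by `w`, started at height `h`,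
is at height `0`. -/
def zeroVisits (h : ℕ) (w : List Bool) : ℕ :=
  ∑ i ∈ Finset.range (w.length + 1),
    if h + (w.take i).count true = (w.take i).count false then 1 else 0

/-- `w` codes a path from height `h` to height `0` which never goes below `0`. -/
def IsDescent (h : ℕ) (w : List Bool) : Prop :=
  (∀ i : ℕ, (w.take i).count false ≤ h + (w.take i).count true) ∧
    w.count false = h + w.count true

/-- The nonnegative paths of length `m` from height `h` to height `0` that visit height `0`
exactly `k` times, the endpoints included. -/
def descents (m h k : ℕ) : Set (List Bool) :=
  {w | w.length = m ∧ IsDescent h w ∧ zeroVisits h w = k}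

/-- The number of elements of `descents m h k`, computed by removing the first step. -/
def descentCount : ℕ → ℕ → ℕ → ℕ
  | 0, 0, 1 => 1
  | 0, _, _ => 0
  | _ + 1, 0, 0 => 0
  | m + 1, 0, k + 1 => descentCount m 1 k
  | m + 1, h + 1, k => descentCount m (h + 2) k + descentCount m h k

lemma zeroVisits_cons_true (h : ℕ) (w : List Bool) :
    zeroVisits h (true :: w) = zeroVisits (h + 1) w + if h = 0 then 1 else 0 := by
  rw [zeroVisits, Finset.sum_range_succ']
  simp [zeroVisits, add_assoc, add_comm 1]

lemma zeroVisits_succ_cons_false (h : ℕ) (w : List Bool) :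
    zeroVisits (h + 1) (false :: w) = zeroVisits h w := by
  rw [zeroVisits, Finset.sum_range_succ']
  simp [zeroVisits, add_right_comm h 1]

lemma isDescent_cons_true (h : ℕ) (w : List Bool) :
    IsDescent h (true :: w) ↔ IsDescent (h + 1) w := by
  rw [IsDescent, ← Nat.and_forall_add_one]
  simp [IsDescent, add_assoc, add_comm 1]

lemma isDescent_succ_cons_false (h : ℕ) (w : List Bool) :
    IsDescent (h + 1) (false :: w) ↔ IsDescent h w := by
  rw [IsDescent, ← Nat.and_forall_add_one]
  simp [IsDescent, add_right_comm h 1]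

lemma not_isDescent_zero_cons_false (w : List Bool) : ¬ IsDescent 0 (false :: w) := by
  intro hw
  simpa using hw.1 1

lemma finite_descents (m h k : ℕ) : (descents m h k).Finite :=
  (List.finite_length_eq Bool m).subset fun _ hw ↦ hw.1

lemma descents_zero (h k : ℕ) : descents 0 h k = if h = 0 ∧ k = 1 then {[]} else ∅ := by
  ext w
  rcases w with _ | ⟨b, w⟩
  · by_cases hh : h = 0 <;> by_cases hk : k = 1 <;>
      simp [descents, IsDescent, zeroVisits, hh, hk, eq_comm]
  · split_ifs <;> simp [descents]

lemma descents_succ_zero_zero (m : ℕ) : descents (m + 1) 0 0 = ∅ := by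
  ext w
  rcases w with _ | ⟨_ | _, w⟩ <;>
    simp [descents, not_isDescent_zero_cons_false, zeroVisits_cons_true]

lemma descents_succ_zero_succ (m k : ℕ) :
    descents (m + 1) 0 (k + 1) = List.cons true '' descents m 1 k := by
  ext w
  rcases w with _ | ⟨_ | _, w⟩ <;>
    simp [descents, not_isDescent_zero_cons_false, isDescent_cons_true, zeroVisits_cons_true]

lemma descents_succ_succ (m h k : ℕ) :
    descents (m + 1) (h + 1) k =
      List.cons true '' descents m (h + 2) k ∪ List.cons false '' descents m h k := by
  ext w
  rcases w with _ | ⟨_ | _, w⟩ <;>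
    simp [descents, isDescent_succ_cons_false, zeroVisits_succ_cons_false,
      isDescent_cons_true, zeroVisits_cons_true]

lemma ncard_descents (m h k : ℕ) : (descents m h k).ncard = descentCount m h k := by
  fun_induction descentCount m h k with
  | case1 => simp [descents_zero]
  | case2 h k hhk =>
    rw [descents_zero, if_neg fun hk ↦ hhk hk.1 hk.2, Set.ncard_empty]
  | case3 m => rw [descents_succ_zero_zero, Set.ncard_empty]
  | case4 m k ih =>
    rw [descents_succ_zero_succ, Set.ncard_image_of_injective _ List.cons_injective, ih]
  | case5 m h k ih₁ ih₂ =>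
    rw [descents_succ_succ, Set.ncard_union_eq _ ((finite_descents _ _ _).image _)
        ((finite_descents _ _ _).image _),
      Set.ncard_image_of_injective _ List.cons_injective,
      Set.ncard_image_of_injective _ List.cons_injective, ih₁, ih₂]
    rw [Set.disjoint_left]
    rintro _ ⟨u, -, rfl⟩ ⟨v, -, huv⟩
    simp at huv

lemma zeroVisits_zero (w : List Bool) : zeroVisits 0 w = dyckReturns w + 1 := by
  rw [zeroVisits, Finset.sum_range_succ', dyckReturns, Finset.card_filter,
    ← Finset.Ico_add_one_right_eq_Icc, Finset.sum_Ico_eq_sum_range]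
  simp [add_comm 1]

lemma dyckCount_eq_descentCount (n k : ℕ) : dyckCount n k = descentCount (2 * n) 0 (k + 1) := by
  rw [← ncard_descents, dyckCount]
  simp [descents, zeroVisits_zero, IsDescent, IsDyckWord]

lemma descentCount_eq_zero (m h k : ℕ) (hm : m + 2 < 2 * k + h) : descentCount m h k = 0 := by
  fun_induction descentCount m h k with
  | case1 => omega
  | case2 => rfl
  | case3 => rfl
  | case4 m k ih => exact ih (by omega)
  | case5 m h k ih₁ ih₂ => rw [ih₁ (by omega), ih₂ (by omega)]

lemma descentCount_zero_right (m h : ℕ) : descentCount m h 0 = 0 := by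
  induction m generalizing h with
  | zero => simp [descentCount]
  | succ m ih => cases h <;> simp [descentCount, ih]

/-- Deleting the first step onto height `0` turns a path from `h + 1` with `k + 1` zero visits
into a path from `h` with at least `k + 1` zero visits. -/
lemma descentCount_succ_succ_succ (m h k N : ℕ) (hN : m + 2 ≤ 2 * N) :
    descentCount (m + 1) (h + 1) (k + 1) =
      ∑ j ∈ Finset.Ico k N, descentCount m h (j + 1) := by
  induction m generalizing h k with
  | zero =>
    have hsum : ∀ j, descentCount 0 h (j + 1) = if j = 0 then descentCount 0 h 1 else 0 := by
      rintro (_ | j) <;> simp [descentCount]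
    rw [descentCount, descentCount_eq_zero 0 (h + 2) _ (by omega), zero_add,
      Finset.sum_congr rfl fun j _ ↦ hsum j, Finset.sum_ite_eq', hsum]
    rcases k with _ | k
    · simp [show 0 < N by omega]
    · simp
  | succ m ih =>
    rw [descentCount, ih _ _ (by omega)]
    rcases h with _ | h
    · simp only [descentCount]
      rcases lt_or_ge k N with hk | hk
      · have hlast : descentCount m 1 N = 0 := descentCount_eq_zero _ _ _ (by omega)
        rw [Finset.sum_Ico_add' (fun j ↦ descentCount m 1 j) k N 1,
          Finset.sum_Ico_succ_top (by omega), hlast, add_zero, add_comm,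
          ← Finset.sum_eq_sum_Ico_succ_bot hk]
      · simp [Finset.Ico_eq_empty_of_le hk, descentCount_eq_zero m 1 k (by omega)]
    · rw [ih _ _ (by omega), ← Finset.sum_add_distrib]
      simp only [descentCount]

/-- For 1 ≤ k ≤ n, the number of Dyck words of semilength n with exactly k
returns equals the sum over j from k-1 to n-1 of the number of Dyck words of
semilength n-1 with exactly j returns. -/
theorem dyckCount_eq_sum (n k : ℕ) (hk : 1 ≤ k) (hkn : k ≤ n) :
    dyckCount n k = ∑ j ∈ Finset.Icc (k - 1) (n - 1), dyckCount (n - 1) j := by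
  obtain ⟨k, rfl⟩ := Nat.exists_eq_add_of_le' hk
  obtain ⟨n, rfl⟩ := Nat.exists_eq_add_of_le' (hk.trans hkn)
  simp only [dyckCount_eq_descentCount, add_tsub_cancel_right, mul_add, mul_one, descentCount]
  rw [← Finset.Ico_add_one_right_eq_Icc]
  exact descentCount_succ_succ_succ _ _ _ _ (by omega)
end

section
/- Let δ ≥ 1 and let G be a δ-regular tree. For every vertex v and every n ≥ 1, the number W_{2n} of closed walks of length 2n at v satisfies W_{2n} = ∑_{k=1}^{n} δ^k·(δ−1)^{n−k}·( ∑_{j=k−1}^{n−1} S(n−1,j) ), where S(n,k) is the number of Dyck words of semilength n with exactly k returns. -/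
open Finset in
/-- The number of returns to `0` of the lattice path that starts at height `d` and follows `w`. -/
def returnsFrom (d : ℕ) (w : List Bool) : ℕ :=
  #{i ∈ Icc 1 w.length | d + (w.take i).count true = (w.take i).count false}

theorem card_filter_Icc_one_succ (m : ℕ) (P : ℕ → Prop) [DecidablePred P] :
    ((Finset.Icc 1 (m + 1)).filter P).card =
      (if P 1 then 1 else 0) + ((Finset.Icc 1 m).filter fun i => P (i + 1)).card := by
  rw [Finset.card_filter, Finset.card_filter, ← Finset.add_sum_Ioc_eq_sum_Icc (by omega),
    ← Finset.Icc_add_one_left_eq_Ioc, ← Finset.Ico_add_one_right_eq_Icc,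
    ← Finset.Ico_add_one_right_eq_Icc, ← Finset.sum_Ico_add']

theorem returnsFrom_true_cons (d : ℕ) (w : List Bool) :
    returnsFrom d (true :: w) = returnsFrom (d + 1) w := by
  rw [returnsFrom, List.length_cons, card_filter_Icc_one_succ]
  simp [returnsFrom, add_assoc, add_comm 1]

theorem returnsFrom_false_cons (d : ℕ) (w : List Bool) :
    returnsFrom (d + 1) (false :: w) = (if d = 0 then 1 else 0) + returnsFrom d w := by
  rw [returnsFrom, List.length_cons, card_filter_Icc_one_succ]
  simp [returnsFrom, add_right_comm]

/-- `IsReturnPath w d k`: the lattice path that starts at height `d` and follows `w` stays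
nonnegative, ends at height `0`, and returns to height `0` exactly `k` times. -/
def IsReturnPath : List Bool → ℕ → ℕ → Prop
  | [], d, k => d = 0 ∧ k = 0
  | true :: w, d, k => IsReturnPath w (d + 1) k
  | false :: _, 0, _ => False
  | false :: _, 1, 0 => False
  | false :: w, 1, k + 1 => IsReturnPath w 0 k
  | false :: w, d + 2, k => IsReturnPath w (d + 1) k

theorem isReturnPath_iff (w : List Bool) (d k : ℕ) :
    IsReturnPath w d k ↔
      (∀ i, (w.take i).count false ≤ d + (w.take i).count true) ∧
        w.count false = d + w.count true ∧ returnsFrom d w = k := by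
  induction w generalizing d k with
  | nil => simp [IsReturnPath, returnsFrom]; omega
  | cons b w ih =>
    rw [← Nat.and_forall_add_one]
    match b, d, k with
    | true, d, k =>
      simp [IsReturnPath, ih, returnsFrom_true_cons, add_assoc, add_comm 1]
    | false, 0, k =>
      simp only [IsReturnPath, false_iff]
      intro h
      simpa using h.1.2 0
    | false, 1, 0 => simp [IsReturnPath, returnsFrom_false_cons 0]
    | false, 1, k + 1 =>
      simp [IsReturnPath, ih, returnsFrom_false_cons 0, add_comm 1]
    | false, d + 2, k =>
      simp [IsReturnPath, ih, returnsFrom_false_cons (d + 1), 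
        add_right_comm _ _ (List.count _ _)]

/-- The number of lattice paths with `m` steps `±1` from height `d` to height `0` that stay
nonnegative and return to height `0` exactly `k` times. -/
def returnPathCount : ℕ → ℕ → ℕ → ℕ
  | 0, 0, 0 => 1
  | 0, 0, _ + 1 => 0
  | 0, _ + 1, _ => 0
  | m + 1, 0, k => returnPathCount m 1 k
  | m + 1, 1, 0 => returnPathCount m 2 0
  | m + 1, 1, k + 1 => returnPathCount m 2 (k + 1) + returnPathCount m 0 k
  | m + 1, d + 2, k => returnPathCount m (d + 3) k + returnPathCount m (d + 1) k

theorem ncard_length_succ_eq_add (m : ℕ) (P : List Bool → Prop) :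
    {w : List Bool | w.length = m + 1 ∧ P w}.ncard =
      {w : List Bool | w.length = m ∧ P (true :: w)}.ncard +
        {w : List Bool | w.length = m ∧ P (false :: w)}.ncard := by
  have hfin (Q : List Bool → Prop) : {w : List Bool | w.length = m ∧ Q w}.Finite :=
    (List.finite_length_eq Bool m).subset fun w hw => hw.1
  rw [← Set.ncard_image_of_injective {w : List Bool | w.length = m ∧ P (true :: w)}
      (List.cons_injective (a := true)),
    ← Set.ncard_image_of_injective {w : List Bool | w.length = m ∧ P (false :: w)}
      (List.cons_injective (a := false)),
    ← Set.ncard_union_eq _ ((hfin _).image _) ((hfin _).image _)]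
  · congr 1
    ext w
    rcases w with _ | ⟨_ | _, w⟩ <;> simp
  · rw [Set.disjoint_left]
    rintro _ ⟨w, -, rfl⟩ ⟨w', -, h⟩
    simp at h

theorem ncard_isReturnPath (m d k : ℕ) :
    {w : List Bool | w.length = m ∧ IsReturnPath w d k}.ncard = returnPathCount m d k := by
  induction m generalizing d k with
  | zero =>
    have h : {w : List Bool | w.length = 0 ∧ IsReturnPath w d k} =
        if d = 0 ∧ k = 0 then {[]} else ∅ := by
      ext w
      rcases w with _ | ⟨b, w⟩ <;> split_ifs <;> simp_all [IsReturnPath]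
    rw [h]
    match d, k with
    | 0, 0 => simp [returnPathCount]
    | 0, k + 1 => simp [returnPathCount]
    | d + 1, k => simp [returnPathCount]
  | succ m ih =>
    rw [ncard_length_succ_eq_add]
    match d, k with
    | 0, k => simp [IsReturnPath, returnPathCount, ih]
    | 1, 0 => simp [IsReturnPath, returnPathCount, ih]
    | 1, k + 1 => simp [IsReturnPath, returnPathCount, ih]
    | d + 2, k => simp [IsReturnPath, returnPathCount, ih]

theorem dyckCount_eq_returnPathCount (n k : ℕ) :
    dyckCount n k = returnPathCount (2 * n) 0 k := by
  rw [← ncard_isReturnPath, dyckCount]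
  congr 1
  ext w
  simp [isReturnPath_iff, IsDyckWord, dyckReturns, returnsFrom, and_assoc]

theorem returnPathCount_succ_zero_right (m d : ℕ) : returnPathCount m (d + 1) 0 = 0 := by
  induction m generalizing d with
  | zero => rfl
  | succ m ih => cases d <;> simp [returnPathCount, ih]

theorem returnPathCount_eq_zero (m k : ℕ) :
    (m < 2 * k → returnPathCount m 0 k = 0) ∧
      ∀ d, m + 1 < d + 2 * k → returnPathCount m (d + 1) k = 0 := by
  induction m generalizing k with
  | zero =>
    refine ⟨fun h => ?_, fun d _ => rfl⟩
    obtain _ | k := k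
    · omega
    · rfl
  | succ m ih =>
    refine ⟨fun h => (ih k).2 0 (by omega), fun d h => ?_⟩
    match d, k with
    | 0, 0 => omega
    | 0, k + 1 =>
      simp [returnPathCount, (ih (k + 1)).2 1 (by omega), (ih k).1 (by omega)]
    | d + 1, k =>
      simp [returnPathCount, (ih k).2 (d + 2) (by omega), (ih k).2 d (by omega)]

/-- Deleting the up-step after the first return trades a return for a unit of initial height. -/
theorem returnPathCount_succ_succ (m d k : ℕ) :
    returnPathCount (m + 1) (d + 1) (k + 2) = returnPathCount m (d + 2) (k + 1) := by
  induction m generalizing d with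
  | zero => cases d <;> simp [returnPathCount]
  | succ m ih =>
    match d with
    | 0 =>
      rw [returnPathCount, ih, returnPathCount, returnPathCount]
    | d + 1 =>
      rw [returnPathCount, ih, ih, returnPathCount]

theorem dyckCount_succ_succ (n k : ℕ) :
    dyckCount (n + 1) (k + 1) = dyckCount n k + dyckCount (n + 1) (k + 2) := by
  have h (j : ℕ) : returnPathCount (2 * n + 2) 0 j = returnPathCount (2 * n + 1) 1 j := by
    rw [returnPathCount]
  simp only [dyckCount_eq_returnPathCount, mul_add_one, h]
  rw [returnPathCount_succ_succ, returnPathCount, add_comm]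

theorem dyckCount_eq_zero {n k : ℕ} (h : n < k) : dyckCount n k = 0 := by
  rw [dyckCount_eq_returnPathCount, (returnPathCount_eq_zero _ _).1 (by omega)]

theorem dyckCount_succ_succ_eq_sum {n k : ℕ} (h : k ≤ n + 1) :
    dyckCount (n + 1) (k + 1) = ∑ j ∈ Finset.Icc k n, dyckCount n j := by
  induction h using Nat.decreasingInduction with
  | self => simp [dyckCount_eq_zero]
  | of_succ k hk ih =>
    rw [dyckCount_succ_succ, ih, ← Finset.add_sum_Ioc_eq_sum_Icc (by omega : k ≤ n),
      Finset.Icc_add_one_left_eq_Ioc]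

/-- The number of walks of length `m` from a vertex at distance `d` from the root to the root
of a `δ`-regular tree. -/
def treeWalkCount (δ : ℕ) : ℕ → ℕ → ℕ
  | 0, 0 => 1
  | 0, _ + 1 => 0
  | m + 1, 0 => δ * treeWalkCount δ m 1
  | m + 1, d + 1 => treeWalkCount δ m d + (δ - 1) * treeWalkCount δ m (d + 2)

theorem treeWalkCount_eq_zero (δ : ℕ) {m d : ℕ} (h : m < d) : treeWalkCount δ m d = 0 := by
  induction m generalizing d with
  | zero => obtain ⟨d, rfl⟩ := Nat.exists_eq_succ_of_ne_zero h.ne'; rfl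
  | succ m ih =>
    obtain ⟨d, rfl⟩ := Nat.exists_eq_succ_of_ne_zero (Nat.ne_zero_of_lt h)
    simp [treeWalkCount, ih (by omega : m < d), ih (by omega : m < d + 2)]

theorem sub_one_mul_treeWalkCount_eq_sum (δ u d : ℕ)
    (h : ∀ u', u = u' + 1 → treeWalkCount δ (2 * u + d) (d + 2) =
      ∑ k ∈ Finset.range u,
        returnPathCount (2 * u + d) (d + 2) (k + 1) * (δ ^ k * (δ - 1) ^ (u' - k))) :
    (δ - 1) * treeWalkCount δ (2 * u + d) (d + 2) =
      ∑ k ∈ Finset.range (u + 1),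
        returnPathCount (2 * u + d) (d + 2) (k + 1) * (δ ^ k * (δ - 1) ^ (u - k)) := by
  rw [Finset.sum_range_succ, (returnPathCount_eq_zero _ _).2 (d + 1) (by omega), zero_mul, add_zero]
  obtain _ | u := u
  · simp [treeWalkCount_eq_zero]
  · rw [h u rfl, Finset.mul_sum]
    refine Finset.sum_congr rfl fun k hk => ?_
    rw [Nat.sub_add_comm (by simpa [Nat.lt_succ_iff] using hk), pow_succ]
    ring

theorem treeWalkCount_eq_sum (δ m : ℕ) :
    (∀ u, m = 2 * u → treeWalkCount δ m 0 =
      ∑ k ∈ Finset.range (u + 1), returnPathCount m 0 k * (δ ^ k * (δ - 1) ^ (u - k))) ∧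
    ∀ u d, m = 2 * u + d + 1 → treeWalkCount δ m (d + 1) =
      ∑ k ∈ Finset.range (u + 1),
        returnPathCount m (d + 1) (k + 1) * (δ ^ k * (δ - 1) ^ (u - k)) := by
  induction m with
  | zero =>
    refine ⟨fun u hu => ?_, fun u d h => by omega⟩
    obtain rfl : u = 0 := by omega
    simp [treeWalkCount, returnPathCount]
  | succ m ih =>
    constructor
    · intro u hu
      obtain ⟨u, rfl⟩ : ∃ u', u = u' + 1 := ⟨u - 1, by omega⟩
      rw [Finset.sum_range_succ', treeWalkCount, ih.2 u 0 (by omega), Finset.mul_sum]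
      simp only [returnPathCount, returnPathCount_succ_zero_right, zero_mul, add_zero, zero_add]
      refine Finset.sum_congr rfl fun k _ => ?_
      rw [Nat.add_sub_add_right, pow_succ]
      ring
    · intro u d hu
      obtain rfl : m = 2 * u + d := by omega
      have key := sub_one_mul_treeWalkCount_eq_sum δ u d fun u' hu' => by
        subst hu'; exact ih.2 u' (d + 1) (by omega)
      rw [treeWalkCount, key]
      match d with
      | 0 =>
        rw [ih.1 u rfl, ← Finset.sum_add_distrib]
        refine Finset.sum_congr rfl fun k _ => ?_
        rw [returnPathCount, add_comm (returnPathCount _ _ _), add_mul]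
        rfl
      | d + 1 =>
        rw [ih.2 u d rfl, ← Finset.sum_add_distrib]
        refine Finset.sum_congr rfl fun k _ => ?_
        rw [returnPathCount, add_comm (returnPathCount _ _ _), add_mul]

namespace SimpleGraph

variable {V : Type*} {G : SimpleGraph V}

theorem IsTree.length_eq_dist_of_isPath (hG : G.IsTree) {u v : V} {p : G.Walk u v}
    (hp : p.IsPath) : p.length = G.dist u v := by
  obtain ⟨q, hq, hlen⟩ := hG.connected.exists_path_of_dist u v
  rw [(hG.existsUnique_path u v).unique hp hq, hlen]

theorem IsTree.exists_adj_dist_eq (hG : G.IsTree) {u v : V} {d : ℕ} (h : G.dist u v = d + 1) :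
    ∃ x, G.Adj u x ∧ G.dist x v = d ∧ ∀ y, G.Adj u y → y ≠ x → G.dist y v = d + 2 := by
  obtain ⟨p, hp, hlen⟩ := hG.connected.exists_path_of_dist u v
  have hnil : ¬ p.Nil := by
    rw [← Walk.length_eq_zero_iff]
    omega
  refine ⟨p.snd, p.adj_snd hnil, ?_, fun y hy hne => ?_⟩
  · rw [← hG.length_eq_dist_of_isPath hp.tail]
    have := p.length_tail_add_one hnil
    omega
  · have hy' : y ∉ p.support := fun hmem => hne (hG.isAcyclic.eq_snd_of_adj_start hp hy hmem)
    rw [← hG.length_eq_dist_of_isPath (hp.cons (h := hy.symm) hy'), Walk.length_cons]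
    omega

theorem card_finsetWalkLength_succ [DecidableEq V] [G.LocallyFinite] (m : ℕ) (u v : V) :
    (G.finsetWalkLength (m + 1) u v).card =
      ∑ x ∈ G.neighborFinset u, (G.finsetWalkLength m x v).card := by
  rw [finsetWalkLength, Finset.card_biUnion]
  · simp_rw [Finset.card_map]
    exact (Finset.sum_subtype (G.neighborFinset u) (fun x => by simp)
      (fun x => (G.finsetWalkLength m x v).card)).symm
  · intro x _ y _ hxy
    rw [Function.onFun, Finset.disjoint_left]
    intro r hp hq
    obtain ⟨p, -, rfl⟩ := Finset.mem_map.1 hp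
    obtain ⟨q, -, hq⟩ := Finset.mem_map.1 hq
    exact hxy (Subtype.ext (Walk.cons.inj hq).1.symm)

theorem IsTree.card_finsetWalkLength [DecidableEq V] [G.LocallyFinite] (hG : G.IsTree) {δ : ℕ}
    (hreg : G.IsRegularOfDegree δ) (m : ℕ) (u v : V) :
    (G.finsetWalkLength m u v).card = treeWalkCount δ m (G.dist u v) := by
  induction m generalizing u with
  | zero =>
    by_cases huv : u = v
    · subst huv
      simp [finsetWalkLength, treeWalkCount]
    · obtain ⟨d, hd⟩ := Nat.exists_eq_succ_of_ne_zero (hG.connected.pos_dist_of_ne huv).ne'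
      simp [finsetWalkLength, treeWalkCount, huv, hd]
  | succ m ih =>
    rw [card_finsetWalkLength_succ]
    simp only [ih]
    obtain hd | ⟨d, hd⟩ : G.dist u v = 0 ∨ ∃ d, G.dist u v = d + 1 := by
      cases G.dist u v <;> simp
    · obtain rfl := hG.connected.dist_eq_zero_iff.1 hd
      rw [hd, treeWalkCount, ← hreg u, ← card_neighborFinset_eq_degree, ← smul_eq_mul,
        ← Finset.sum_const]
      refine Finset.sum_congr rfl fun x hx => ?_
      rw [dist_comm, dist_eq_one_iff_adj.2 (by simpa using hx)]
    · obtain ⟨x, hx, hxd, hother⟩ := hG.exists_adj_dist_eq hd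
      have hmem : x ∈ G.neighborFinset u := by simpa using hx
      rw [hd, treeWalkCount, ← Finset.add_sum_erase _ _ hmem, hxd, ← hreg u,
        ← card_neighborFinset_eq_degree, ← Finset.card_erase_of_mem hmem, ← smul_eq_mul,
        ← Finset.sum_const]
      congr 1
      refine Finset.sum_congr rfl fun y hy => ?_
      rw [Finset.mem_erase, mem_neighborFinset] at hy
      rw [hother y hy.2 hy.1]

end SimpleGraph

/-- In a δ-regular tree, the number of closed walks of length 2n at a vertex v
equals the stated double sum involving S(n-1, j). -/
theorem closed_walks_tree_count {V : Type*} (G : SimpleGraph V)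
    [G.LocallyFinite] (δ : ℕ) (hδ : 1 ≤ δ)
    (hreg : G.IsRegularOfDegree δ) (htree : G.IsTree) (v : V)
    (n : ℕ) (hn : 1 ≤ n) :
    Set.ncard {p : G.Walk v v | p.length = 2 * n}
      = ∑ k ∈ Finset.Icc 1 n, δ ^ k * (δ - 1) ^ (n - k) *
          ∑ j ∈ Finset.Icc (k - 1) (n - 1), dyckCount (n - 1) j := by
  classical
  obtain ⟨n, rfl⟩ : ∃ n', n = n' + 1 := ⟨n - 1, by omega⟩
  rw [← G.coe_finsetWalkLength_eq, Set.ncard_coe_finset, htree.card_finsetWalkLength hreg,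
    SimpleGraph.dist_self, (treeWalkCount_eq_sum δ _).1 (n + 1) rfl, Finset.sum_range_succ',
    ← Finset.Ico_add_one_right_eq_Icc, Finset.sum_Ico_eq_sum_range]
  have hzero : returnPathCount (2 * (n + 1)) 0 0 = 0 := returnPathCount_succ_zero_right _ _
  rw [hzero, zero_mul, add_zero]
  refine Finset.sum_congr rfl fun k hk => ?_
  rw [Finset.mem_range] at hk
  rw [← dyckCount_eq_returnPathCount, dyckCount_succ_succ_eq_sum (by omega), add_comm 1 k,
    mul_comm, Nat.add_sub_cancel, Nat.add_sub_cancel]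
end

section
/- Let δ ≥ 1 and let G be a δ-regular tree. For every vertex v and every n ≥ 2, the number of closed walks of length 2n at v that visit v exactly three times (the start, exactly one intermediate visit, and the end) equals δ²·(δ−1)^{n−2}·C_{n−1}, where C_{n−1} is the (n−1)-st Catalan number. -/
/-- Weighted number of lattice paths on `ℕ` with `m` steps from height `d` to height `0`, visiting
height `0` exactly `k` times: down-steps have weight `1`, up-steps have weight `δ` at height `0`
and `δ - 1` elsewhere. -/
def weightedPathCount (δ : ℕ) : ℕ → ℕ → ℕ → ℕ
  | 0, k, d => if d = 0 ∧ k = 1 then 1 else 0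
  | _ + 1, 0, 0 => 0
  | m + 1, k + 1, 0 => δ * weightedPathCount δ m k 1
  | m + 1, k, d + 1 =>
      weightedPathCount δ m k d + (δ - 1) * weightedPathCount δ m k (d + 2)

theorem weightedPathCount_zero_visits (δ m d : ℕ) : weightedPathCount δ m 0 d = 0 := by
  induction m generalizing d with
  | zero => simp [weightedPathCount]
  | succ m ih => cases d <;> simp [weightedPathCount, ih]

theorem weightedPathCount_add_two_visits (δ m k d : ℕ) :
    weightedPathCount δ (m + 1) (k + 2) d = δ * weightedPathCount δ m (k + 1) (d + 1) := by
  induction m generalizing d with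
  | zero => cases d <;> simp [weightedPathCount]
  | succ m ih =>
    cases d with
    | zero => simp [weightedPathCount]
    | succ d => rw [weightedPathCount, ih, ih, weightedPathCount]; ring

/-- The number of lattice paths with `j` up-steps and `d + j` down-steps from height `d`
that reach height `0` only at the end. -/
def firstPassageCount : ℕ → ℕ → ℕ
  | 0, 0 => 1
  | 0, _ + 1 => 0
  | d + 1, 0 => firstPassageCount d 0
  | d + 1, j + 1 => firstPassageCount d (j + 1) + firstPassageCount (d + 2) j
termination_by d j => d + 2 * j

theorem firstPassageCount_zero_right (d : ℕ) : firstPassageCount d 0 = 1 := by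
  induction d with
  | zero => simp [firstPassageCount]
  | succ d ih => rw [firstPassageCount, ih]

theorem weightedPathCount_one_visit_of_lt (δ : ℕ) {m d : ℕ} (h : m < d) :
    weightedPathCount δ m 1 d = 0 := by
  induction m generalizing d with
  | zero => simp [weightedPathCount]; omega
  | succ m ih =>
    obtain ⟨d, rfl⟩ := Nat.exists_eq_succ_of_ne_zero (Nat.ne_zero_of_lt h)
    rw [weightedPathCount, ih (by omega), ih (by omega)]; simp

theorem weightedPathCount_one_visit (δ d j : ℕ) :
    weightedPathCount δ (d + 2 * j) 1 d = (δ - 1) ^ j * firstPassageCount d j := by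
  induction d, j using firstPassageCount.induct with
  | case1 => simp [weightedPathCount, firstPassageCount]
  | case2 j =>
    rw [show 0 + 2 * (j + 1) = (2 * j + 1) + 1 by ring, weightedPathCount,
      weightedPathCount_zero_visits]
    simp [firstPassageCount]
  | case3 d ih =>
    simp only [mul_zero, add_zero] at ih ⊢
    rw [weightedPathCount, ih, weightedPathCount_one_visit_of_lt δ (by omega), firstPassageCount]
    simp
  | case4 d j ih₁ ih₂ =>
    rw [show d + 1 + 2 * (j + 1) = (d + 2 * (j + 1)) + 1 by ring, weightedPathCount, ih₁,
      show d + 2 * (j + 1) = d + 2 + 2 * j by ring, ih₂, firstPassageCount]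
    rw [pow_succ]
    ring

theorem firstPassageCount_add_choose (d j : ℕ) :
    firstPassageCount (d + 1) (j + 1) + (d + 2 * j + 2).choose j =
      (d + 2 * j + 2).choose (j + 1) := by
  induction j generalizing d with
  | zero =>
    induction d with
    | zero => simp [firstPassageCount]
    | succ d ih =>
      rw [firstPassageCount]
      simp [firstPassageCount_zero_right] at ih ⊢
      omega
  | succ j ihj =>
    induction d with
    | zero =>
      have h := ihj 1
      rw [firstPassageCount, firstPassageCount]
      have e₁ := Nat.choose_succ_succ (2 * j + 3) j
      have e₂ := Nat.choose_succ_succ (2 * j + 3) (j + 1)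
      have e₃ : (2 * j + 3).choose (j + 1) = (2 * j + 3).choose (j + 2) :=
        Nat.choose_symm_of_eq_add (by ring)
      simp only [Nat.succ_eq_add_one] at e₁ e₂
      ring_nf at *
      omega
    | succ d ihd =>
      have h := ihj (d + 2)
      rw [firstPassageCount]
      have e₁ := Nat.choose_succ_succ (d + 2 * j + 4) j
      have e₂ := Nat.choose_succ_succ (d + 2 * j + 4) (j + 1)
      simp only [Nat.succ_eq_add_one] at e₁ e₂
      ring_nf at *
      omega

theorem firstPassageCount_two (j : ℕ) : firstPassageCount 2 j = catalan (j + 1) := by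
  have h := firstPassageCount_add_choose 0 j
  have hc := succ_mul_catalan_eq_centralBinom (j + 1)
  have hs := Nat.choose_succ_right_eq (2 * j + 2) j
  rw [firstPassageCount, firstPassageCount, zero_add, zero_add, zero_add] at h
  rw [Nat.centralBinom, show 2 * (j + 1) = 2 * j + 2 by ring] at hc
  rw [show 2 * j + 2 - j = j + 2 by omega] at hs
  have : (j + 2) * firstPassageCount 2 j = (j + 2) * catalan (j + 1) := by
    nlinarith
  exact Nat.eq_of_mul_eq_mul_left (by omega) this

theorem weightedPathCount_three_visits (δ n : ℕ) (hn : 2 ≤ n) :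
    weightedPathCount δ (2 * n) 3 0 = δ ^ 2 * (δ - 1) ^ (n - 2) * catalan (n - 1) := by
  obtain ⟨n, rfl⟩ := Nat.exists_eq_add_of_le' hn
  rw [show 2 * (n + 2) = (2 + 2 * n) + 1 + 1 by ring, weightedPathCount_add_two_visits,
    weightedPathCount_add_two_visits, weightedPathCount_one_visit, firstPassageCount_two]
  simp only [Nat.add_sub_cancel, show n + 2 - 1 = n + 1 by omega]
  ring

namespace SimpleGraph

variable {V : Type*} {G : SimpleGraph V}

theorem Connected.exists_adj_dist_eq (hG : G.Connected) {u v : V} {d : ℕ}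
    (hd : G.dist u v = d + 1) : ∃ w, G.Adj u w ∧ G.dist w v = d := by
  obtain ⟨p, hp⟩ := hG.exists_walk_length_eq_dist u v
  cases p with
  | nil => simp at hd
  | @cons _ w _ h p =>
    refine ⟨w, h, ?_⟩
    have h₁ := dist_le p
    have h₂ := hG.dist_triangle (u := u) (v := w) (w := v)
    rw [dist_eq_one_iff_adj.mpr h] at h₂
    rw [Walk.length_cons] at hp
    omega

theorem IsTree.eq_of_adj_of_dist_eq (hG : G.IsTree) {u v w w' : V} {d : ℕ}
    (hd : G.dist u v = d + 1) (hw : G.Adj u w) (hw' : G.Adj u w')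
    (hdw : G.dist w v = d) (hdw' : G.dist w' v = d) : w = w' := by
  obtain ⟨p, hp⟩ := hG.connected.exists_walk_length_eq_dist w v
  obtain ⟨p', hp'⟩ := hG.connected.exists_walk_length_eq_dist w' v
  have h₁ : (Walk.cons hw p).IsPath := Walk.isPath_of_length_eq_dist _ (by simp; omega)
  have h₂ : (Walk.cons hw' p').IsPath := Walk.isPath_of_length_eq_dist _ (by simp; omega)
  have h := congrArg (fun q : G.Path u v => q.1.snd)
    ((hG.isAcyclic.subsingleton_path u v).elim ⟨_, h₁⟩ ⟨_, h₂⟩)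
  simpa using h

theorem IsTree.sum_neighborFinset_dist [G.LocallyFinite] (hG : G.IsTree) {u v : V} {d : ℕ}
    (hd : G.dist u v = d + 1) (f : ℕ → ℕ) :
    ∑ w ∈ G.neighborFinset u, f (G.dist w v) = f d + (G.degree u - 1) * f (d + 2) := by
  classical
  obtain ⟨w, hw, hdw⟩ := hG.connected.exists_adj_dist_eq hd
  have hmem : w ∈ G.neighborFinset u := by simpa using hw
  rw [← Finset.add_sum_erase _ _ hmem, hdw, Finset.sum_congr rfl (g := fun _ => f (d + 2)),
    Finset.sum_const, Finset.card_erase_of_mem hmem, card_neighborFinset_eq_degree, smul_eq_mul]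
  intro x hx
  rw [Finset.mem_erase, mem_neighborFinset] at hx
  have h := hG.dist_eq_dist_add_one_of_adj v hx.2
  rw [dist_comm (u := v), dist_comm (u := v)] at h
  have hne : G.dist x v ≠ d := fun hx' => hx.1 (hG.eq_of_adj_of_dist_eq hd hx.2 hw hx' hdw)
  congr 1
  omega

/-- Splitting off the first step of a walk of given length and number of visits to `v`. -/
def walkVisitsEquiv [DecidableEq V] (u v : V) (m k : ℕ) :
    {p : G.Walk u v // p.length = m + 1 ∧ p.support.count v = k} ≃
      Σ w : G.neighborSet u, {p : G.Walk w v //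
        p.length = m ∧ p.support.count v + (if u = v then 1 else 0) = k} where
  toFun
    | ⟨.cons (v := w) h p, hp⟩ => ⟨⟨w, h⟩, p, by
        simpa [List.count_cons] using hp⟩
  invFun x := ⟨.cons ((G.mem_neighborSet _ _).mp x.1.2) x.2.1, by
    obtain ⟨h₁, h₂⟩ := x.2.2
    rw [Walk.length_cons, Walk.support_cons, List.count_cons, h₁]
    simpa using h₂⟩
  left_inv := by
    rintro ⟨p, hp⟩
    cases p with
    | nil => simp at hp
    | cons h p => rfl
  right_inv x := rfl

theorem IsTree.card_walks_eq_weightedPathCount [DecidableEq V] [G.LocallyFinite] {δ : ℕ}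
    (hreg : G.IsRegularOfDegree δ) (hG : G.IsTree) (v : V) (m k : ℕ) (u : V) :
    Finite {p : G.Walk u v // p.length = m ∧ p.support.count v = k} ∧
    Nat.card {p : G.Walk u v // p.length = m ∧ p.support.count v = k} =
      weightedPathCount δ m k (G.dist u v) := by
  induction m generalizing k u with
  | zero =>
    by_cases h : u = v
    · subst h
      have hs (p : G.Walk u u) : p.length = 0 ∧ p.support.count u = k ↔ p = .nil ∧ k = 1 := by
        cases p <;> simp [eq_comm]
      by_cases hk : k = 1
      · have e := Equiv.subtypeEquivRight hs
        simp only [hk, and_true] at e ⊢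
        refine ⟨.of_equiv _ e.symm, ?_⟩
        rw [Nat.card_congr e, Nat.card_unique]
        simp [weightedPathCount]
      · have : IsEmpty {p : G.Walk u u // p.length = 0 ∧ p.support.count u = k} :=
          ⟨fun p => hk ((hs _).mp p.2).2⟩
        refine ⟨inferInstance, ?_⟩
        rw [Nat.card_of_isEmpty]
        simp [weightedPathCount, hk]
    · have : IsEmpty {p : G.Walk u v // p.length = 0 ∧ p.support.count v = k} :=
        ⟨fun p => h (Walk.eq_of_length_eq_zero p.2.1)⟩
      refine ⟨inferInstance, ?_⟩
      rw [Nat.card_of_isEmpty]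
      simp [weightedPathCount, hG.connected.dist_eq_zero_iff, h]
  | succ m ih =>
    by_cases h : u = v
    · subst h
      have e := walkVisitsEquiv (G := G) u u m k
      simp only [if_true] at e
      cases k with
      | zero =>
        have : IsEmpty {p : G.Walk u u // p.length = m + 1 ∧ p.support.count u = 0} :=
          ⟨fun p => by simpa using (e p).2.2.2⟩
        refine ⟨inferInstance, ?_⟩
        simp [weightedPathCount]
      | succ k =>
        simp only [Nat.add_right_cancel_iff] at e
        have hfin (w : V) := (ih k w).1
        refine ⟨Finite.of_equiv _ e.symm, ?_⟩
        rw [Nat.card_congr e, Nat.card_sigma]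
        have hd (w : G.neighborSet u) : G.dist w.1 u = 1 := dist_eq_one_iff_adj.mpr w.2.symm
        simp only [(ih k _).2, hd, Finset.sum_const, Finset.card_univ, card_neighborSet_eq_degree,
          hreg.degree_eq, dist_self, weightedPathCount, smul_eq_mul]
    · have e := walkVisitsEquiv (G := G) u v m k
      simp only [if_neg h, add_zero] at e
      have hfin (w : V) := (ih k w).1
      refine ⟨Finite.of_equiv _ e.symm, ?_⟩
      obtain ⟨d, hd⟩ := Nat.exists_eq_succ_of_ne_zero
        (mt (hG.connected.dist_eq_zero_iff).mp h)
      rw [Nat.card_congr e, Nat.card_sigma, hd, weightedPathCount, ← hreg.degree_eq u,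
        ← hG.sum_neighborFinset_dist hd (weightedPathCount _ m k)]
      simp only [(ih k _).2, hreg.degree_eq]
      exact (Finset.sum_subtype (p := (· ∈ G.neighborSet u)) _ (fun w => by simp)
        (fun w => weightedPathCount δ m k (G.dist w v))).symm

end SimpleGraph

/-- In a δ-regular tree, the number of closed walks of length 2n at v that visit
v exactly three times (start, one intermediate visit, and end) is
δ^2 * (δ-1)^(n-2) * C_(n-1). -/
theorem second_return_walks_count {V : Type*} [DecidableEq V]
    (G : SimpleGraph V) [G.LocallyFinite] (δ : ℕ) (hδ : 1 ≤ δ)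
    (hreg : G.IsRegularOfDegree δ) (htree : G.IsTree) (v : V)
    (n : ℕ) (hn : 2 ≤ n) :
    Set.ncard {p : G.Walk v v | p.length = 2 * n ∧ p.support.count v = 3}
      = δ ^ 2 * (δ - 1) ^ (n - 2) * catalan (n - 1) := by
  rw [← weightedPathCount_three_visits δ n hn]
  have h := (htree.card_walks_eq_weightedPathCount hreg v (2 * n) 3 v).2
  rwa [SimpleGraph.dist_self] at h
end

section
/- For every n ≥ 1, the following identity holds in the polynomial ring ℤ[x]: ∑_{k=1}^{n} x^k·(x−1)^{n−k}·C(n−1, n−k) = ∑_{ℓ=1}^{n} (−1)^{n−ℓ}·B(n−1, n−ℓ)·x^ℓ, where C(n,k) is the Catalan triangle entry and B(n,k) is the Borel triangle entry. -/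
/-- The Catalan triangle entry `C(n,k) = choose (n+k) k - choose (n+k) (k-1)`
(with the convention that the binomial coefficient at index `-1` is `0`). -/
def catalanTriangle (n k : ℕ) : ℕ :=
  (n + k).choose k - if k = 0 then 0 else (n + k).choose (k - 1)

/-- The Borel triangle entry `B(n,k) = ∑_{s=k}^{n} choose s k * C(n,s)`. -/
def borelTriangle (n k : ℕ) : ℕ :=
  ∑ s ∈ Finset.Icc k n, s.choose k * catalanTriangle n s

theorem Finset.sum_Icc_one_succ_eq_sum_range_reflect {M : Type*} [AddCommMonoid M] (N : ℕ)
    (f : ℕ → M) :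
    ∑ k ∈ Finset.Icc 1 (N + 1), f k = ∑ s ∈ Finset.range (N + 1), f (N + 1 - s) := by
  refine Finset.sum_nbij' (fun k => N + 1 - k) (fun s => N + 1 - s) ?_ ?_ ?_ ?_ ?_ <;>
    intro k hk <;> simp only [Finset.mem_Icc, Finset.mem_range] at hk ⊢
  · omega
  · omega
  · omega
  · omega
  · congr 1
    omega

theorem pow_sub_mul_sub_one_pow {R : Type*} [CommRing R] (x : R) {m s : ℕ} (hs : s ≤ m) :
    x ^ (m - s) * (x - 1) ^ s
      = ∑ j ∈ Finset.range (s + 1), (-1) ^ j * (s.choose j : R) * x ^ (m - j) := by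
  rw [sub_eq_neg_add, add_pow, Finset.mul_sum]
  refine Finset.sum_congr rfl fun j hj => ?_
  have hj' : j ≤ s := by simpa [Nat.lt_succ_iff] using hj
  rw [show m - j = (m - s) + (s - j) by omega, pow_add]
  ring

open Polynomial in
/-- The polynomial identity in ℤ[x] relating the Catalan triangle and the Borel
triangle. -/
theorem catalanTriangle_borelTriangle_poly_identity (n : ℕ) (hn : 1 ≤ n) :
    ∑ k ∈ Finset.Icc 1 n, (X : ℤ[X]) ^ k * (X - 1) ^ (n - k) *
        (catalanTriangle (n - 1) (n - k) : ℤ[X])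
      = ∑ l ∈ Finset.Icc 1 n,
          (-1 : ℤ[X]) ^ (n - l) * (borelTriangle (n - 1) (n - l) : ℤ[X]) * X ^ l := by
  obtain ⟨N, rfl⟩ := Nat.exists_eq_add_of_le' hn
  simp only [Finset.sum_Icc_one_succ_eq_sum_range_reflect, Nat.add_sub_cancel]
  calc
    _ = ∑ s ∈ Finset.range (N + 1), ∑ j ∈ Finset.range (s + 1),
          (-1 : ℤ[X]) ^ j * (s.choose j : ℤ[X]) * X ^ (N + 1 - j) *
            (catalanTriangle N s : ℤ[X]) := by
      refine Finset.sum_congr rfl fun s hs => ?_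
      have hs' : s ≤ N + 1 := (Finset.mem_range.mp hs).le
      rw [Nat.sub_sub_self hs', pow_sub_mul_sub_one_pow X hs', Finset.sum_mul]
    _ = ∑ j ∈ Finset.range (N + 1), ∑ s ∈ Finset.Icc j N,
          (-1 : ℤ[X]) ^ j * (s.choose j : ℤ[X]) * X ^ (N + 1 - j) *
            (catalanTriangle N s : ℤ[X]) := by
      refine Finset.sum_comm' fun s j => ?_
      simp only [Finset.mem_range, Finset.mem_Icc]
      omega
    _ = _ := by
      refine Finset.sum_congr rfl fun j hj => ?_
      rw [Nat.sub_sub_self (Finset.mem_range.mp hj).le, borelTriangle, Nat.cast_sum,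
        Finset.mul_sum, Finset.sum_mul]
      refine Finset.sum_congr rfl fun s _ => ?_
      push_cast
      ring
end
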